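/- For real coefficients α₁,…,α₆, β₁, β₂, β₃, the quadratic combination W̄ = α₁L̄² + α₂L̄M̄₁ + α₃L̄M̄₂ + α₄M̄₁² + α₅M̄₁M̄₂ + α₆M̄₂² + β₁M̄₁R̄₂ + β₂M̄₂R̄₁ + β₃M̄₂R̄₂ of the differential S-Heun operators equals the second-order differential operator Q₃(x) d²/dx² + Q₂(x) d/dx + Q₁(x) on ℝ[x], where Q₃(x) = α₁ + α₃x + α₆x² + β₃x³, Q₂(x) = (α₂+α₃) + (α₅+α₆)x + (β₁+β₂+2β₃)x², Q₁(x) = α₄ + β₂x. Conversely, for every triple of polynomials Q₃, Q₂, Q₁ with deg Q₃ ≤ 3, deg Q₂ ≤ 2, deg Q₁ ≤ 1 there exist real α₁,…,α₆, β₁, β₂, β₃ realizing it. Hence the generic (differential) Heun operator Q₃(x)d²/dx² + Q₂(x)d/dx + Q₁(x) is exactly the most general quadratic combination of the differential S-Heun operators that does not raise the degree of polynomials by more than one. -/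

import Mathlib

open Polynomial

/-- Differential S-Heun operator `L̄ = d/dx` on `ℝ[x]`. -/
noncomputable def Lb (p : ℝ[X]) : ℝ[X] := derivative p
/-- Differential S-Heun operator `M̄₁ = 1` (identity). -/
def M1b (p : ℝ[X]) : ℝ[X] := p
/-- Differential S-Heun operator `M̄₂ = x d/dx`. -/
noncomputable def M2b (p : ℝ[X]) : ℝ[X] := X * derivative p
/-- Differential S-Heun operator `R̄₁ = x` (multiplication by the variable). -/
noncomputable def R1b (p : ℝ[X]) : ℝ[X] := X * p
/-- Differential S-Heun operator `R̄₂ = x² d/dx`. -/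
noncomputable def R2b (p : ℝ[X]) : ℝ[X] := X^2 * derivative p

/-- The general quadratic combination
`W̄ = α₁L̄² + α₂L̄M̄₁ + α₃L̄M̄₂ + α₄M̄₁² + α₅M̄₁M̄₂ + α₆M̄₂² + β₁M̄₁R̄₂ + β₂M̄₂R̄₁ + β₃M̄₂R̄₂`. -/
noncomputable def Wbar (α₁ α₂ α₃ α₄ α₅ α₆ β₁ β₂ β₃ : ℝ) (p : ℝ[X]) : ℝ[X] :=
  C α₁ * Lb (Lb p) + C α₂ * Lb (M1b p) + C α₃ * Lb (M2b p)
  + C α₄ * M1b (M1b p) + C α₅ * M1b (M2b p) + C α₆ * M2b (M2b p)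
  + C β₁ * M1b (R2b p) + C β₂ * M2b (R1b p) + C β₃ * M2b (R2b p)

/-- The generic differential Heun operator `Q₃(x)d²/dx² + Q₂(x)d/dx + Q₁(x)` is exactly
the most general quadratic combination of the differential S-Heun operators that does not
raise the degree of polynomials by more than one. -/
theorem stmt_14 :
    (∀ α₁ α₂ α₃ α₄ α₅ α₆ β₁ β₂ β₃ : ℝ, ∀ p : ℝ[X],
      Wbar α₁ α₂ α₃ α₄ α₅ α₆ β₁ β₂ β₃ p
        = (C α₁ + C α₃ * X + C α₆ * X^2 + C β₃ * X^3) * derivative (derivative p)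
          + (C (α₂ + α₃) + C (α₅ + α₆) * X + C (β₁ + β₂ + 2*β₃) * X^2) * derivative p
          + (C α₄ + C β₂ * X) * p) ∧
    (∀ Q₃ Q₂ Q₁ : ℝ[X], Q₃.degree ≤ (3 : ℕ) → Q₂.degree ≤ (2 : ℕ) → Q₁.degree ≤ (1 : ℕ) →
      ∃ α₁ α₂ α₃ α₄ α₅ α₆ β₁ β₂ β₃ : ℝ, ∀ p : ℝ[X],
        Wbar α₁ α₂ α₃ α₄ α₅ α₆ β₁ β₂ β₃ p
          = Q₃ * derivative (derivative p) + Q₂ * derivative p + Q₁ * p) := by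
  have key : ∀ α₁ α₂ α₃ α₄ α₅ α₆ β₁ β₂ β₃ : ℝ, ∀ p : ℝ[X],
      Wbar α₁ α₂ α₃ α₄ α₅ α₆ β₁ β₂ β₃ p
        = (C α₁ + C α₃ * X + C α₆ * X^2 + C β₃ * X^3) * derivative (derivative p)
          + (C (α₂ + α₃) + C (α₅ + α₆) * X + C (β₁ + β₂ + 2*β₃) * X^2) * derivative p
          + (C α₄ + C β₂ * X) * p := by
    intro α₁ α₂ α₃ α₄ α₅ α₆ β₁ β₂ β₃ p
    have h2 : (C (2 : ℝ) : ℝ[X]) = 2 := rfl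
    simp only [Wbar, Lb, M1b, M2b, R1b, R2b, derivative_mul, derivative_X, derivative_X_pow,
      C_add, C_mul, h2]
    norm_num [h2]
    ring
  refine ⟨key, ?_⟩
  intro Q₃ Q₂ Q₁ h3 h2 h1
  refine ⟨Q₃.coeff 0, Q₂.coeff 0 - Q₃.coeff 1, Q₃.coeff 1, Q₁.coeff 0,
    Q₂.coeff 1 - Q₃.coeff 2, Q₃.coeff 2, Q₂.coeff 2 - Q₁.coeff 1 - 2 * Q₃.coeff 3,
    Q₁.coeff 1, Q₃.coeff 3, ?_⟩
  intro p
  have e3 : Q₃ = C (Q₃.coeff 0) + C (Q₃.coeff 1) * X + C (Q₃.coeff 2) * X^2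
      + C (Q₃.coeff 3) * X^3 := by
    have h := Q₃.as_sum_range' 4 (by
      have := natDegree_le_iff_degree_le.mpr h3
      omega)
    simpa [Finset.sum_range_succ, ← C_mul_X_pow_eq_monomial] using h
  have e2 : Q₂ = C (Q₂.coeff 0) + C (Q₂.coeff 1) * X + C (Q₂.coeff 2) * X^2 := by
    have h := Q₂.as_sum_range' 3 (by
      have := natDegree_le_iff_degree_le.mpr h2
      omega)
    simpa [Finset.sum_range_succ, ← C_mul_X_pow_eq_monomial] using h
  have e1 : Q₁ = C (Q₁.coeff 0) + C (Q₁.coeff 1) * X := by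
    have h := Q₁.as_sum_range' 2 (by
      have := natDegree_le_iff_degree_le.mpr h1
      omega)
    simpa [Finset.sum_range_succ, ← C_mul_X_pow_eq_monomial] using h
  rw [key]
  have a1 : Q₂.coeff 0 - Q₃.coeff 1 + Q₃.coeff 1 = Q₂.coeff 0 := by ring
  have a2 : Q₂.coeff 1 - Q₃.coeff 2 + Q₃.coeff 2 = Q₂.coeff 1 := by ring
  have a3 : Q₂.coeff 2 - Q₁.coeff 1 - 2 * Q₃.coeff 3 + Q₁.coeff 1 + 2 * Q₃.coeff 3
      = Q₂.coeff 2 := by ring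
  rw [a1, a2, a3, ← e3, ← e2, ← e1]
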